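/- There exist constants c₀ > 0 and C > 0, depending only on γ, such that for every positive integer m which is a sum of two squares and for all t₁, t₂ ∈ [0,L] with 0 < |t₂ − t₁| < c₀/√m, the two-point correlation function satisfies K₂(t₁,t₂) ≤ C · m, where, with α = 2π²m, K₂(t₁,t₂) = (π² (1−r²)^{3/2})^{-1} · μ · ( √(1−ρ²) + ρ · arcsin ρ ), μ = √(α(1−r²) − r₁²) · √(α(1−r²) − r₂²), and ρ = (r₁₂(1−r²) + r·r₁·r₂)/μ (with the convention K₂ = 0 when μ = 0), all quantities r, r₁, r₂, r₁₂ being evaluated at (t₁,t₂). -/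

import Mathlib

open MeasureTheory ProbabilityTheory Real

noncomputable section

/-- The set of lattice points on the circle of radius `√m`:
`E = {μ ∈ ℤ² : μ₁² + μ₂² = m}` (all solutions satisfy `|μᵢ| ≤ m`). -/
def latticeSet (m : ℕ) : Finset (ℤ × ℤ) :=
  (Finset.Icc (-(m : ℤ)) (m : ℤ) ×ˢ Finset.Icc (-(m : ℤ)) (m : ℤ)).filter
    (fun μ => μ.1 ^ 2 + μ.2 ^ 2 = (m : ℤ))

/-- `N = #E`, the number of lattice points on the circle of radius `√m`. -/
def latN (m : ℕ) : ℕ := (latticeSet m).card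

/-- The covariance function of the wave restricted to the curve:
`r(t₁,t₂) = N⁻¹ ∑_{μ ∈ E} cos(2π⟨μ, γ(t₁) − γ(t₂)⟩)`. -/
def covFn (m : ℕ) (γ : ℝ → ℝ × ℝ) (t₁ t₂ : ℝ) : ℝ :=
  ((latN m : ℝ))⁻¹ *
    ∑ μ ∈ latticeSet m,
      Real.cos (2 * π * ((μ.1 : ℝ) * (γ t₁ - γ t₂).1 + (μ.2 : ℝ) * (γ t₁ - γ t₂).2))

/-- `r₁ = ∂r/∂t₁`. -/
def covFn1 (m : ℕ) (γ : ℝ → ℝ × ℝ) (t₁ t₂ : ℝ) : ℝ :=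
  deriv (fun s => covFn m γ s t₂) t₁

/-- `r₂ = ∂r/∂t₂`. -/
def covFn2 (m : ℕ) (γ : ℝ → ℝ × ℝ) (t₁ t₂ : ℝ) : ℝ :=
  deriv (fun s => covFn m γ t₁ s) t₂

/-- `r₁₂ = ∂²r/∂t₁∂t₂`. -/
def covFn12 (m : ℕ) (γ : ℝ → ℝ × ℝ) (t₁ t₂ : ℝ) : ℝ :=
  deriv (fun s => deriv (fun u => covFn m γ s u) t₂) t₁

theorem mem_latticeSet {m : ℕ} {p : ℤ × ℤ} : p ∈ latticeSet m ↔ p.1 ^ 2 + p.2 ^ 2 = (m : ℤ) := by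
  simp only [latticeSet, Finset.mem_filter, Finset.mem_product, Finset.mem_Icc,
    and_iff_right_iff_imp]
  intro h
  refine ⟨⟨?_, ?_⟩, ?_, ?_⟩ <;> by_contra! hc <;> nlinarith [sq_nonneg p.1, sq_nonneg p.2]

theorem latN_pos {m : ℕ} (h : ∃ a b : ℤ, a ^ 2 + b ^ 2 = (m : ℤ)) : (0 : ℝ) < latN m := by
  obtain ⟨a, b, h⟩ := h
  exact_mod_cast Finset.card_pos.mpr ⟨(a, b), mem_latticeSet.mpr h⟩

theorem sum_latticeSet_fst_mul_snd (m : ℕ) :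
    ∑ p ∈ latticeSet m, (p.1 : ℝ) * p.2 = 0 := by
  have h : ∑ p ∈ latticeSet m, (p.1 : ℝ) * p.2 = ∑ p ∈ latticeSet m, -((p.1 : ℝ) * p.2) := by
    refine Finset.sum_nbij' (fun p => (p.1, -p.2)) (fun p => (p.1, -p.2)) ?_ ?_ ?_ ?_ ?_ <;>
      simp [mem_latticeSet]
  rw [Finset.sum_neg_distrib] at h
  linarith

theorem sum_latticeSet_sq (m : ℕ) :
    ∑ p ∈ latticeSet m, (p.1 : ℝ) ^ 2 = latN m * (m / 2) ∧
      ∑ p ∈ latticeSet m, (p.2 : ℝ) ^ 2 = latN m * (m / 2) := by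
  have h : ∑ p ∈ latticeSet m, (p.1 : ℝ) ^ 2 = ∑ p ∈ latticeSet m, (p.2 : ℝ) ^ 2 := by
    refine Finset.sum_nbij' Prod.swap Prod.swap ?_ ?_ ?_ ?_ ?_ <;>
      simp [mem_latticeSet, add_comm]
  have h' : ∑ p ∈ latticeSet m, ((p.1 : ℝ) ^ 2 + (p.2 : ℝ) ^ 2) = latN m * m := by
    rw [Finset.sum_congr rfl (g := fun _ => (m : ℝ)), Finset.sum_const, nsmul_eq_mul, latN]
    intro p hp
    exact_mod_cast mem_latticeSet.mp hp
  rw [Finset.sum_add_distrib] at h'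
  constructor <;> linarith

/-- Isotropy of the second moments of the lattice points on a circle. -/
theorem latticeSet_second_moment {m : ℕ} (hN : (0 : ℝ) < latN m) (a b c d : ℝ) :
    (latN m : ℝ)⁻¹ * ∑ p ∈ latticeSet m, (p.1 * a + p.2 * b) * (p.1 * c + p.2 * d) =
      m / 2 * (a * c + b * d) := by
  have h : ∑ p ∈ latticeSet m, ((p.1 : ℝ) * a + p.2 * b) * (p.1 * c + p.2 * d) =
      (∑ p ∈ latticeSet m, (p.1 : ℝ) ^ 2) * (a * c) +
      (∑ p ∈ latticeSet m, (p.2 : ℝ) ^ 2) * (b * d) +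
      (∑ p ∈ latticeSet m, (p.1 : ℝ) * p.2) * (a * d + b * c) := by
    simp only [Finset.sum_mul, ← Finset.sum_add_distrib]
    exact Finset.sum_congr rfl fun p _ => by ring
  rw [h, (sum_latticeSet_sq m).1, (sum_latticeSet_sq m).2, sum_latticeSet_fst_mul_snd]
  field_simp
  ring

theorem abs_latticeSet_average_sub_le {m : ℕ} (hN : (0 : ℝ) < latN m) {f g : ℤ × ℤ → ℝ} {ε : ℝ}
    (h : ∀ p ∈ latticeSet m, |f p - g p| ≤ ε) :
    |(latN m : ℝ)⁻¹ * ∑ p ∈ latticeSet m, f p - (latN m : ℝ)⁻¹ * ∑ p ∈ latticeSet m, g p| ≤ ε := by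
  rw [← mul_sub, ← Finset.sum_sub_distrib, abs_mul, abs_of_pos (inv_pos.mpr hN)]
  have h' : |∑ p ∈ latticeSet m, (f p - g p)| ≤ latN m * ε := by
    refine (Finset.abs_sum_le_sum_abs _ _).trans ((Finset.sum_le_sum h).trans ?_)
    rw [Finset.sum_const, nsmul_eq_mul, latN]
  calc _ ≤ (latN m : ℝ)⁻¹ * (latN m * ε) := by gcongr
    _ = ε := by field_simp

/-- The phase `2π⟨μ, (a, b)⟩` of a lattice point. -/
def latticePhase (p : ℤ × ℤ) (a b : ℝ) : ℝ := 2 * π * (p.1 * a + p.2 * b)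

theorem latticePhase_sq_le {m : ℕ} {p : ℤ × ℤ} (hp : p ∈ latticeSet m) (a b : ℝ) :
    latticePhase p a b ^ 2 ≤ 2 * (2 * π ^ 2 * m) * (a ^ 2 + b ^ 2) := by
  have h : (p.1 : ℝ) ^ 2 + (p.2 : ℝ) ^ 2 = m := by exact_mod_cast mem_latticeSet.mp hp
  rw [latticePhase, ← h]
  have : (p.1 * a + p.2 * b : ℝ) ^ 2 ≤ (p.1 ^ 2 + p.2 ^ 2) * (a ^ 2 + b ^ 2) := by
    nlinarith [sq_nonneg ((p.1 : ℝ) * b - p.2 * a)]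
  nlinarith [mul_le_mul_of_nonneg_left this (by positivity : 0 ≤ 4 * π ^ 2)]

theorem latticePhase_second_moment {m : ℕ} (hN : (0 : ℝ) < latN m) (a b c d : ℝ) :
    (latN m : ℝ)⁻¹ * ∑ p ∈ latticeSet m, latticePhase p a b * latticePhase p c d =
      2 * π ^ 2 * m * (a * c + b * d) := by
  have h : ∑ p ∈ latticeSet m, latticePhase p a b * latticePhase p c d =
      4 * π ^ 2 * ∑ p ∈ latticeSet m, (p.1 * a + p.2 * b) * (p.1 * c + p.2 * d) := by
    rw [Finset.mul_sum]
    exact Finset.sum_congr rfl fun p _ => by rw [latticePhase, latticePhase]; ring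
  rw [h, mul_left_comm, latticeSet_second_moment hN]
  ring

theorem latticeSet_average_cos_bound {m : ℕ} (hN : (0 : ℝ) < latN m) {a b q : ℝ}
    (hq : 2 * π ^ 2 * m * (a ^ 2 + b ^ 2) ≤ q) (hq1 : q ≤ 1 / 2) :
    |(latN m : ℝ)⁻¹ * ∑ p ∈ latticeSet m, cos (latticePhase p a b) -
      (1 - 2 * π ^ 2 * m * (a ^ 2 + b ^ 2) / 2)| ≤ q ^ 2 := by
  have h := abs_latticeSet_average_sub_le hN (f := fun p => cos (latticePhase p a b))
    (g := fun p => 1 - latticePhase p a b * latticePhase p a b / 2) (ε := q ^ 2) ?_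
  · rw [Finset.sum_sub_distrib, ← Finset.sum_div, mul_sub, ← mul_div_assoc,
      latticePhase_second_moment hN, Finset.sum_const, nsmul_eq_mul, ← latN] at h
    convert h using 3
    field_simp
  · intro p hp
    have hx := latticePhase_sq_le hp a b
    set x := latticePhase p a b
    have hx1 : |x| ≤ 1 := by rw [← sq_le_one_iff_abs_le_one]; linarith
    have hb := Real.cos_bound hx1
    rw [pow_abs, abs_of_nonneg (by positivity : 0 ≤ x ^ 4)] at hb
    rw [← pow_two]
    nlinarith [sq_nonneg x]

theorem latticeSet_average_sin_bound {m : ℕ} (hN : (0 : ℝ) < latN m) {a b c d s q : ℝ}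
    (hcd : c ^ 2 + d ^ 2 = 1) (hab : a ^ 2 + b ^ 2 ≤ s ^ 2) (hq : q = 2 * π ^ 2 * m * s ^ 2)
    (hq1 : q ≤ 1 / 2) :
    |(latN m : ℝ)⁻¹ * ∑ p ∈ latticeSet m, latticePhase p c d * sin (latticePhase p a b) -
      2 * π ^ 2 * m * (c * a + d * b)| ≤ 4 * (2 * π ^ 2 * m) * |s| * q := by
  rw [← latticePhase_second_moment hN]
  refine abs_latticeSet_average_sub_le hN fun p hp => ?_
  have hx := latticePhase_sq_le hp a b
  have hy := latticePhase_sq_le hp c d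
  set x := latticePhase p a b
  set y := latticePhase p c d
  set A := 2 * π ^ 2 * (m : ℝ)
  have hA : 0 ≤ A := by positivity
  rw [hcd, mul_one] at hy
  have hxq : x ^ 2 ≤ 2 * q := by nlinarith
  have hx1 : |x| ≤ 1 := by rw [← sq_le_one_iff_abs_le_one]; linarith
  have hb := Real.sin_bound hx1
  have hs : |sin x - x| ≤ |x| * x ^ 2 := by
    have h1 : |sin x - x| ≤ |sin x - (x - x ^ 3 / 6)| + |x ^ 3 / 6| := by
      rw [← abs_neg (x ^ 3 / 6)]
      refine le_trans (le_of_eq ?_) (abs_add_le _ _)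
      congr 1; ring
    have h2 : |x ^ 3 / 6| = |x| * x ^ 2 / 6 := by
      rw [abs_div, abs_pow, pow_succ, sq_abs, abs_of_pos (by norm_num : (0 : ℝ) < 6)]; ring
    have h3 : |x| ^ 5 ≤ |x| * x ^ 2 := by
      rw [← sq_abs x, ← pow_succ']
      exact pow_le_pow_of_le_one (abs_nonneg x) hx1 (by norm_num)
    have h4 : 0 ≤ |x| * x ^ 2 := by positivity
    linarith
  have hxy : |y| * |x| ≤ 2 * A * |s| := by
    rw [← abs_mul]
    refine abs_le_of_sq_le_sq ?_ (by positivity)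
    rw [mul_pow, mul_pow, sq_abs]
    calc y ^ 2 * x ^ 2 ≤ (2 * A) * (2 * A * s ^ 2) := by
          apply mul_le_mul hy _ (sq_nonneg _) (by positivity)
          exact hx.trans (by gcongr)
      _ = _ := by ring
  rw [← mul_sub, abs_mul]
  calc |y| * |sin x - x| ≤ |y| * (|x| * x ^ 2) := by gcongr
    _ = (|y| * |x|) * x ^ 2 := by ring
    _ ≤ (2 * A * |s|) * (2 * q) := by gcongr
    _ = _ := by ring

theorem latticeSet_average_mul_cos_bound {m : ℕ} (hN : (0 : ℝ) < latN m) {a b c d c' d' q : ℝ}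
    (hcd : c ^ 2 + d ^ 2 = 1) (hcd' : c' ^ 2 + d' ^ 2 = 1)
    (hq : 2 * π ^ 2 * m * (a ^ 2 + b ^ 2) ≤ q) :
    |(latN m : ℝ)⁻¹ * ∑ p ∈ latticeSet m,
        latticePhase p c d * latticePhase p c' d' * cos (latticePhase p a b) -
      2 * π ^ 2 * m * (c * c' + d * d')| ≤ 2 * (2 * π ^ 2 * m) * q := by
  rw [← latticePhase_second_moment hN]
  refine abs_latticeSet_average_sub_le hN fun p hp => ?_
  have hx := latticePhase_sq_le hp a b
  have hy := latticePhase_sq_le hp c d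
  have hz := latticePhase_sq_le hp c' d'
  set x := latticePhase p a b
  set y := latticePhase p c d
  set z := latticePhase p c' d'
  set A := 2 * π ^ 2 * (m : ℝ)
  have hA : 0 ≤ A := by positivity
  rw [hcd, mul_one] at hy
  rw [hcd', mul_one] at hz
  have hyz : |y * z| ≤ 2 * A := abs_le.mpr
    ⟨by nlinarith [sq_nonneg (y + z)], by nlinarith [sq_nonneg (y - z)]⟩
  have hc : |cos x - 1| ≤ q := abs_le.mpr
    ⟨by linarith [one_sub_sq_div_two_le_cos (x := x)], by nlinarith [cos_le_one x, sq_nonneg x]⟩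
  rw [show y * z * cos x - y * z = y * z * (cos x - 1) by ring, abs_mul]
  gcongr

section Derivatives

variable {γ : ℝ → ℝ × ℝ}

theorem HasDerivAt.mul_fst_add_mul_snd {f : ℝ → ℝ × ℝ} {f' : ℝ × ℝ} {t : ℝ}
    (h : HasDerivAt f f' t) (a b : ℝ) :
    HasDerivAt (fun s => a * (f s).1 + b * (f s).2) (a * f'.1 + b * f'.2) t :=
  (((ContinuousLinearMap.fst ℝ ℝ ℝ).hasFDerivAt.comp_hasDerivAt t h).const_mul a).add
    (((ContinuousLinearMap.snd ℝ ℝ ℝ).hasFDerivAt.comp_hasDerivAt t h).const_mul b)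

theorem hasDerivAt_latticePhase_left (p : ℤ × ℤ) (w : ℝ × ℝ) (hγ : Differentiable ℝ γ) (t : ℝ) :
    HasDerivAt (fun s => latticePhase p (γ s - w).1 (γ s - w).2)
      (latticePhase p (deriv γ t).1 (deriv γ t).2) t := by
  have h := ((hγ t).hasDerivAt).sub_const w
  exact (h.mul_fst_add_mul_snd p.1 p.2).const_mul (2 * π)

theorem hasDerivAt_latticePhase_right (p : ℤ × ℤ) (w : ℝ × ℝ) (hγ : Differentiable ℝ γ) (t : ℝ) :
    HasDerivAt (fun s => latticePhase p (w - γ s).1 (w - γ s).2)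
      (-latticePhase p (deriv γ t).1 (deriv γ t).2) t := by
  have h := ((hγ t).hasDerivAt).const_sub w
  refine ((h.mul_fst_add_mul_snd p.1 p.2).const_mul (2 * π)).congr_deriv ?_
  rw [latticePhase, Prod.fst_neg, Prod.snd_neg]
  ring

theorem covFn1_eq (m : ℕ) (hγ : Differentiable ℝ γ) (t₁ t₂ : ℝ) :
    covFn1 m γ t₁ t₂ = -((latN m : ℝ)⁻¹ * ∑ p ∈ latticeSet m,
      latticePhase p (deriv γ t₁).1 (deriv γ t₁).2 *
        sin (latticePhase p (γ t₁ - γ t₂).1 (γ t₁ - γ t₂).2)) := by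
  have h : HasDerivAt (fun s => covFn m γ s t₂) _ t₁ :=
    (HasDerivAt.fun_sum fun p (_ : p ∈ latticeSet m) =>
      (hasDerivAt_latticePhase_left p (γ t₂) hγ t₁).cos).const_mul (latN m : ℝ)⁻¹
  rw [covFn1, h.deriv, ← mul_neg, ← Finset.sum_neg_distrib]
  congr 1
  exact Finset.sum_congr rfl fun p _ => by ring

theorem deriv_covFn_right (m : ℕ) (hγ : Differentiable ℝ γ) (t₁ t₂ : ℝ) :
    deriv (fun s => covFn m γ t₁ s) t₂ = (latN m : ℝ)⁻¹ * ∑ p ∈ latticeSet m,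
      latticePhase p (deriv γ t₂).1 (deriv γ t₂).2 *
        sin (latticePhase p (γ t₁ - γ t₂).1 (γ t₁ - γ t₂).2) := by
  have h : HasDerivAt (fun s => covFn m γ t₁ s) _ t₂ :=
    (HasDerivAt.fun_sum fun p (_ : p ∈ latticeSet m) =>
      (hasDerivAt_latticePhase_right p (γ t₁) hγ t₂).cos).const_mul (latN m : ℝ)⁻¹
  rw [h.deriv]
  congr 1
  exact Finset.sum_congr rfl fun p _ => by ring

theorem covFn12_eq (m : ℕ) (hγ : Differentiable ℝ γ) (t₁ t₂ : ℝ) :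
    covFn12 m γ t₁ t₂ = (latN m : ℝ)⁻¹ * ∑ p ∈ latticeSet m,
      latticePhase p (deriv γ t₁).1 (deriv γ t₁).2 *
        latticePhase p (deriv γ t₂).1 (deriv γ t₂).2 *
        cos (latticePhase p (γ t₁ - γ t₂).1 (γ t₁ - γ t₂).2) := by
  simp only [covFn12, deriv_covFn_right m hγ]
  have h := (HasDerivAt.fun_sum fun p (_ : p ∈ latticeSet m) =>
      ((hasDerivAt_latticePhase_left p (γ t₂) hγ t₁).sin).const_mul
        (latticePhase p (deriv γ t₂).1 (deriv γ t₂).2)).const_mul (latN m : ℝ)⁻¹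
  rw [h.deriv]
  congr 1
  exact Finset.sum_congr rfl fun p _ => by ring

end Derivatives

section Geometry

variable {γ : ℝ → ℝ × ℝ} {L : ℝ}

/-- Quadratic Lipschitz bound for the tangent vector on a compact interval. -/
theorem exists_deriv_sub_sq_le (hγ : ContDiff ℝ (⊤ : ℕ∞) γ) :
    ∃ B : ℝ, 0 ≤ B ∧ ∀ x ∈ Set.Icc (0 : ℝ) L, ∀ y ∈ Set.Icc (0 : ℝ) L,
      ((deriv γ x).1 - (deriv γ y).1) ^ 2 + ((deriv γ x).2 - (deriv γ y).2) ^ 2 ≤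
        B * (x - y) ^ 2 := by
  have h1 : ContDiff ℝ 1 (deriv γ) := (hγ.of_le (by norm_cast) : ContDiff ℝ 2 γ).deriv'
  obtain ⟨M, hM⟩ := isCompact_Icc.exists_bound_of_continuousOn
    (s := Set.Icc (0 : ℝ) L) (h1.continuous_deriv le_rfl).continuousOn
  refine ⟨2 * M ^ 2, by positivity, fun x hx y hy => ?_⟩
  have h := (convex_Icc (0 : ℝ) L).norm_image_sub_le_of_norm_deriv_le
    (fun z _ => (h1.differentiable one_ne_zero) z) hM hy hx
  rw [Prod.norm_def, sup_le_iff] at h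
  obtain ⟨ha, hb⟩ := h
  have ha' := pow_le_pow_left₀ (norm_nonneg _) ha 2
  have hb' := pow_le_pow_left₀ (norm_nonneg _) hb 2
  simp only [Real.norm_eq_abs, sq_abs, mul_pow, Prod.fst_sub, Prod.snd_sub] at ha' hb'
  linarith

theorem exists_chord_inner_eq (hγ : Differentiable ℝ γ) {t₁ t₂ : ℝ} (h1 : t₁ ∈ Set.Icc 0 L)
    (h2 : t₂ ∈ Set.Icc 0 L) (a b : ℝ) :
    ∃ ξ ∈ Set.Icc 0 L, |t₁ - ξ| ≤ |t₁ - t₂| ∧ |t₂ - ξ| ≤ |t₁ - t₂| ∧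
      a * (γ t₁ - γ t₂).1 + b * (γ t₁ - γ t₂).2 =
        (a * (deriv γ ξ).1 + b * (deriv γ ξ).2) * (t₁ - t₂) := by
  have hd : ∀ t, HasDerivAt (fun s => a * (γ s).1 + b * (γ s).2)
      (a * (deriv γ t).1 + b * (deriv γ t).2) t := fun t =>
    (hγ t).hasDerivAt.mul_fst_add_mul_snd a b
  have hc : Continuous fun s => a * (γ s).1 + b * (γ s).2 :=
    continuous_iff_continuousAt.mpr fun t => (hd t).continuousAt
  obtain ⟨l1, u1⟩ := h1
  obtain ⟨l2, u2⟩ := h2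
  rcases lt_trichotomy t₁ t₂ with h | rfl | h
  · obtain ⟨ξ, ⟨hl, hu⟩, he⟩ := exists_hasDerivAt_eq_slope _ _ h hc.continuousOn fun t _ => hd t
    refine ⟨ξ, ⟨by linarith, by linarith⟩, ?_, ?_, ?_⟩
    · rw [abs_of_neg, abs_of_neg] <;> linarith
    · rw [abs_of_pos, abs_of_neg] <;> linarith
    · rw [he, Prod.fst_sub, Prod.snd_sub]
      have : t₂ - t₁ ≠ 0 := by linarith
      field_simp
      ring
  · exact ⟨t₁, ⟨l1, u1⟩, by simp, by simp, by simp⟩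
  · obtain ⟨ξ, ⟨hl, hu⟩, he⟩ := exists_hasDerivAt_eq_slope _ _ h hc.continuousOn fun t _ => hd t
    refine ⟨ξ, ⟨by linarith, by linarith⟩, ?_, ?_, ?_⟩
    · rw [abs_of_pos, abs_of_pos] <;> linarith
    · rw [abs_of_neg, abs_of_pos] <;> linarith
    · rw [he, Prod.fst_sub, Prod.snd_sub]
      have : t₁ - t₂ ≠ 0 := by linarith
      field_simp
      ring

theorem inner_sq_le_of_unit {c d : ℝ} (h : c ^ 2 + d ^ 2 = 1) (a b : ℝ) :
    (c * a + d * b) ^ 2 ≤ a ^ 2 + b ^ 2 := by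
  rw [← one_mul (a ^ 2 + b ^ 2), ← h]
  nlinarith [sq_nonneg (c * b - d * a)]

theorem chord_sq_le (hγ : Differentiable ℝ γ)
    (hunit : ∀ t ∈ Set.Icc (0:ℝ) L, (deriv γ t).1 ^ 2 + (deriv γ t).2 ^ 2 = 1)
    {t₁ t₂ : ℝ} (h1 : t₁ ∈ Set.Icc 0 L) (h2 : t₂ ∈ Set.Icc 0 L) :
    (γ t₁ - γ t₂).1 ^ 2 + (γ t₁ - γ t₂).2 ^ 2 ≤ (t₁ - t₂) ^ 2 := by
  obtain ⟨ξ, hξ, -, -, he⟩ := exists_chord_inner_eq hγ h1 h2 (γ t₁ - γ t₂).1 (γ t₁ - γ t₂).2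
  have hu := hunit ξ hξ
  set a := (γ t₁ - γ t₂).1
  set b := (γ t₁ - γ t₂).2
  set c := (deriv γ ξ).1
  set d := (deriv γ ξ).2
  have : (a - c * (t₁ - t₂)) ^ 2 + (b - d * (t₁ - t₂)) ^ 2 =
      (c ^ 2 + d ^ 2) * (t₁ - t₂) ^ 2 - (a ^ 2 + b ^ 2) := by linear_combination 2 * he
  rw [hu] at this
  nlinarith [sq_nonneg (a - c * (t₁ - t₂)), sq_nonneg (b - d * (t₁ - t₂))]

theorem tangent_inner_bounds
    (hunit : ∀ t ∈ Set.Icc (0:ℝ) L, (deriv γ t).1 ^ 2 + (deriv γ t).2 ^ 2 = 1) {B : ℝ}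
    (hB : ∀ x ∈ Set.Icc (0 : ℝ) L, ∀ y ∈ Set.Icc (0 : ℝ) L,
      ((deriv γ x).1 - (deriv γ y).1) ^ 2 + ((deriv γ x).2 - (deriv γ y).2) ^ 2 ≤
        B * (x - y) ^ 2)
    {x y : ℝ} (hx : x ∈ Set.Icc 0 L) (hy : y ∈ Set.Icc 0 L) :
    |(deriv γ x).1 * (deriv γ y).1 + (deriv γ x).2 * (deriv γ y).2 - 1| ≤ B * (x - y) ^ 2 := by
  have h := hB x hx y hy
  have h1 := hunit x hx
  have h2 := hunit y hy
  have h3 := sq_nonneg ((deriv γ x).1 - (deriv γ y).1)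
  have h4 := sq_nonneg ((deriv γ x).2 - (deriv γ y).2)
  rw [abs_le]
  constructor <;> nlinarith

theorem exists_tangent_chord_eq (hγ : Differentiable ℝ γ)
    (hunit : ∀ t ∈ Set.Icc (0:ℝ) L, (deriv γ t).1 ^ 2 + (deriv γ t).2 ^ 2 = 1) {B : ℝ}
    (hB0 : 0 ≤ B)
    (hB : ∀ x ∈ Set.Icc (0 : ℝ) L, ∀ y ∈ Set.Icc (0 : ℝ) L,
      ((deriv γ x).1 - (deriv γ y).1) ^ 2 + ((deriv γ x).2 - (deriv γ y).2) ^ 2 ≤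
        B * (x - y) ^ 2)
    {t₁ t₂ t : ℝ} (h1 : t₁ ∈ Set.Icc 0 L) (h2 : t₂ ∈ Set.Icc 0 L) (ht : t = t₁ ∨ t = t₂) :
    ∃ a : ℝ, |a - 1| ≤ B * (t₁ - t₂) ^ 2 ∧
      (deriv γ t).1 * (γ t₁ - γ t₂).1 + (deriv γ t).2 * (γ t₁ - γ t₂).2 = a * (t₁ - t₂) := by
  obtain ⟨ξ, hξ, hl, hr, he⟩ := exists_chord_inner_eq hγ h1 h2 (deriv γ t).1 (deriv γ t).2
  refine ⟨_, ?_, he⟩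
  have ht' : t ∈ Set.Icc 0 L := by rcases ht with rfl | rfl <;> assumption
  refine (tangent_inner_bounds hunit hB ht' hξ).trans ?_
  have : (t - ξ) ^ 2 ≤ (t₁ - t₂) ^ 2 := by
    rw [sq_le_sq]; rcases ht with rfl | rfl <;> assumption
  gcongr

end Geometry

theorem mul_sqrt_add_mul_arcsin_le {μ : ℝ} (hμ : 0 ≤ μ) (ρ : ℝ) :
    μ * (√(1 - ρ ^ 2) + ρ * arcsin ρ) ≤ μ + 2 * (μ * |ρ|) := by
  have hsq : √(1 - ρ ^ 2) ≤ 1 := sqrt_le_one.mpr (by linarith [sq_nonneg ρ])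
  have has : ρ * arcsin ρ ≤ |ρ| * 2 := by
    refine (le_abs_self _).trans ?_
    rw [abs_mul]
    gcongr
    rw [abs_le]
    constructor <;> linarith [neg_pi_div_two_le_arcsin ρ, arcsin_le_pi_div_two ρ, pi_le_four]
  calc μ * (√(1 - ρ ^ 2) + ρ * arcsin ρ) ≤ μ * (1 + |ρ| * 2) := by gcongr
    _ = μ + 2 * (μ * |ρ|) := by ring

theorem abs_expansion_numerator_le {δ e₁ e₂ e₃ e₄ e₅ : ℝ} (hδ : δ ≤ 1 / 10)
    (h₁ : |e₁| ≤ δ) (h₂ : |e₂| ≤ δ) (h₃ : |e₃| ≤ δ) (h₄ : |e₄| ≤ 3 * δ) (h₅ : |e₅| ≤ δ) :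
    |(1 + e₃) * (1 + e₄) - (1 + e₅) * ((1 + e₁) * (1 + e₂))| ≤ 10 * δ := by
  have hprod : ∀ {x y a b : ℝ}, |x| ≤ a → |y| ≤ b → |x * y| ≤ a * b := fun hx hy => by
    rw [abs_mul]
    exact mul_le_mul hx hy (abs_nonneg _) ((abs_nonneg _).trans hx)
  have hδ0 : 0 ≤ δ := (abs_nonneg _).trans h₁
  have hδ2 : δ * δ ≤ δ / 10 := by nlinarith
  have h34 := hprod h₃ h₄
  have h12 := hprod h₁ h₂
  have hw : |e₁ + e₂ + e₁ * e₂| ≤ 3 * δ := by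
    rw [abs_le] at h₁ h₂ h12 ⊢
    constructor <;> linarith
  have h5w := hprod h₅ hw
  rw [show (1 + e₃) * (1 + e₄) - (1 + e₅) * ((1 + e₁) * (1 + e₂)) =
    e₃ + e₄ + e₃ * e₄ - e₅ - (e₁ + e₂ + e₁ * e₂) - e₅ * (e₁ + e₂ + e₁ * e₂) by ring]
  rw [show δ * (3 * δ) = 3 * (δ * δ) by ring] at h34 h5w
  rw [abs_le] at h₃ h₄ h₅ h34 h5w hw ⊢
  constructor <;> linarith

open scoped Classical in
/-- Bound for the two-point correlation function from the second-order expansion of the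
covariance and its derivatives at the diagonal, in terms of `q = A s²`. -/
theorem two_point_correlation_le_of_expansion {A s q K r r₁ r₂ r₁₂ e₀ e₁ e₂ e₃ : ℝ} (hA : 0 < A)
    (hs : s ≠ 0) (hq : q = A * s ^ 2) (hK : 1 ≤ K) (hKq : K * q ≤ 1 / 10)
    (hr : r = 1 - q / 2 + q * e₀) (hr₁ : r₁ = -(A * s * (1 + e₁))) (hr₂ : r₂ = A * s * (1 + e₂))
    (hr₁₂ : r₁₂ = A * (1 + e₃)) (h₀ : |e₀| ≤ K * q) (h₁ : |e₁| ≤ K * q) (h₂ : |e₂| ≤ K * q)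
    (h₃ : |e₃| ≤ K * q) :
    (let μv : ℝ := √(A * (1 - r ^ 2) - r₁ ^ 2) * √(A * (1 - r ^ 2) - r₂ ^ 2)
     let ρv : ℝ := (r₁₂ * (1 - r ^ 2) + r * r₁ * r₂) / μv
     let K₂ : ℝ := if μv = 0 then 0 else
       (π ^ 2 * (1 - r ^ 2) ^ ((3:ℝ)/2))⁻¹ * μv * (√(1 - ρv ^ 2) + ρv * arcsin ρv)
     K₂ ≤ 100 * K * A) := by
  intro μv ρv K₂
  have hq0 : 0 < q := by rw [hq]; positivity
  set δ := K * q with hδ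
  have hqδ : q ≤ δ := by nlinarith
  obtain ⟨e₄, he₄, h₄⟩ : ∃ e₄, 1 - r ^ 2 = q * (1 + e₄) ∧ |e₄| ≤ 3 * δ := by
    refine ⟨-2 * e₀ - q * (1 / 2 - e₀) ^ 2, by rw [hr]; ring, ?_⟩
    rw [abs_le] at h₀ ⊢
    have : (1 / 2 - e₀) ^ 2 ≤ 1 := by nlinarith
    have : q * (1 / 2 - e₀) ^ 2 ≤ δ := by nlinarith [sq_nonneg (1 / 2 - e₀)]
    have : 0 ≤ q * (1 / 2 - e₀) ^ 2 := by positivity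
    constructor <;> linarith
  obtain ⟨e₅, he₅, h₅⟩ : ∃ e₅, r = 1 + e₅ ∧ |e₅| ≤ δ := by
    refine ⟨-q / 2 + q * e₀, by rw [hr]; ring, ?_⟩
    rw [abs_le] at h₀ ⊢
    constructor <;> nlinarith
  have hvar : ∀ e, |e| ≤ δ → A * (q * (1 + e₄)) - A * q * (1 + e) ^ 2 ≤ 5 * δ * q * A := by
    intro e he
    rw [abs_le] at he h₄
    have : (1 + e₄) - (1 + e) ^ 2 ≤ 5 * δ := by nlinarith [sq_nonneg e]
    nlinarith [mul_le_mul_of_nonneg_left this (mul_pos hA hq0).le]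
  have hv1 : A * (1 - r ^ 2) - r₁ ^ 2 ≤ 5 * δ * q * A := by
    rw [he₄, hr₁, show (-(A * s * (1 + e₁))) ^ 2 = A * q * (1 + e₁) ^ 2 by rw [hq]; ring]
    exact hvar _ h₁
  have hv2 : A * (1 - r ^ 2) - r₂ ^ 2 ≤ 5 * δ * q * A := by
    rw [he₄, hr₂, show (A * s * (1 + e₂)) ^ 2 = A * q * (1 + e₂) ^ 2 by rw [hq]; ring]
    exact hvar _ h₂
  have hδ0 : 0 ≤ δ := hq0.le.trans hqδ
  have hμ : μv ≤ 5 * δ * q * A := by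
    have h0 : 0 ≤ 5 * δ * q * A := by positivity
    calc μv ≤ √(5 * δ * q * A) * √(5 * δ * q * A) :=
          mul_le_mul (sqrt_le_sqrt hv1) (sqrt_le_sqrt hv2) (sqrt_nonneg _) (sqrt_nonneg _)
      _ = _ := mul_self_sqrt h0
  have hnum : |r₁₂ * (1 - r ^ 2) + r * r₁ * r₂| ≤ 10 * δ * q * A := by
    have key : r₁₂ * (1 - r ^ 2) + r * r₁ * r₂ =
        A * q * ((1 + e₃) * (1 + e₄) - (1 + e₅) * ((1 + e₁) * (1 + e₂))) := by
      rw [he₄, hr₁, hr₂, hr₁₂, he₅, hq]; ring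
    have := abs_expansion_numerator_le (by linarith) h₁ h₂ h₃ h₄ h₅
    rw [key, abs_mul, abs_of_pos (mul_pos hA hq0)]
    nlinarith [mul_le_mul_of_nonneg_left this (mul_pos hA hq0).le]
  have hD : q ^ 2 / 4 ≤ (1 - r ^ 2) ^ ((3:ℝ)/2) := by
    have hlow : q / 2 ≤ 1 - r ^ 2 := by
      rw [he₄]; rw [abs_le] at h₄; nlinarith
    calc q ^ 2 / 4 = (q / 2) ^ 2 := by ring
      _ ≤ (1 - r ^ 2) ^ 2 := by gcongr
      _ = (1 - r ^ 2) ^ (2 : ℝ) := by norm_cast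
      _ ≤ _ := rpow_le_rpow_of_exponent_ge (by linarith) (by nlinarith [sq_nonneg r]) (by norm_num)
  by_cases hμ0 : μv = 0
  · simp only [K₂, if_pos hμ0]; positivity
  simp only [K₂, if_neg hμ0]
  have hμpos : 0 < μv := lt_of_le_of_ne (by positivity) (Ne.symm hμ0)
  have hμρ : μv * |ρv| = |r₁₂ * (1 - r ^ 2) + r * r₁ * r₂| := by
    simp only [ρv]
    rw [abs_div, abs_of_pos hμpos, mul_div_cancel₀ _ hμ0]
  have hfac : μv * (√(1 - ρv ^ 2) + ρv * arcsin ρv) ≤ 25 * δ * q * A := by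
    calc μv * (√(1 - ρv ^ 2) + ρv * arcsin ρv) ≤ μv + 2 * (μv * |ρv|) :=
          mul_sqrt_add_mul_arcsin_le hμpos.le ρv
      _ ≤ 5 * δ * q * A + 2 * (10 * δ * q * A) := by rw [hμρ]; gcongr
      _ = _ := by ring
  have hden : q ^ 2 / 4 ≤ π ^ 2 * (1 - r ^ 2) ^ ((3:ℝ)/2) :=
    hD.trans (le_mul_of_one_le_left ((by positivity : 0 ≤ q ^ 2 / 4).trans hD)
      (one_le_pow₀ (by linarith [pi_gt_three])))
  have hden0 : 0 < q ^ 2 / 4 := by positivity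
  rw [mul_assoc, inv_mul_le_iff₀ (hden0.trans_le hden)]
  calc _ ≤ 25 * δ * q * A := hfac
    _ = q ^ 2 / 4 * (100 * K * A) := by rw [hδ]; ring
    _ ≤ _ := by gcongr

open scoped Classical in
/-- Near-diagonal bound `K₂(t₁,t₂) = O(m)` for the two-point correlation function. -/
theorem two_point_correlation_near_diagonal_bound
    (L : ℝ) (hL : 0 < L) (γ : ℝ → ℝ × ℝ) (hγ : ContDiff ℝ (⊤ : ℕ∞) γ)
    (hunit : ∀ t ∈ Set.Icc (0:ℝ) L, (deriv γ t).1 ^ 2 + (deriv γ t).2 ^ 2 = 1)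
    (hcurv : ∀ t ∈ Set.Icc (0:ℝ) L, deriv (deriv γ) t ≠ 0) :
    ∃ c₀ > 0, ∃ C > 0, ∀ m : ℕ, 0 < m →
      (∃ a b : ℤ, a ^ 2 + b ^ 2 = (m : ℤ)) →
      ∀ t₁ ∈ Set.Icc (0:ℝ) L, ∀ t₂ ∈ Set.Icc (0:ℝ) L, t₁ ≠ t₂ →
        |t₂ - t₁| < c₀ / Real.sqrt m →
        (let α : ℝ := 2 * π ^ 2 * m
         let r : ℝ := covFn m γ t₁ t₂
         let μv : ℝ := Real.sqrt (α * (1 - r ^ 2) - covFn1 m γ t₁ t₂ ^ 2) *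
           Real.sqrt (α * (1 - r ^ 2) - covFn2 m γ t₁ t₂ ^ 2)
         let ρv : ℝ :=
           (covFn12 m γ t₁ t₂ * (1 - r ^ 2) + r * covFn1 m γ t₁ t₂ * covFn2 m γ t₁ t₂) / μv
         let K₂ : ℝ := if μv = 0 then 0 else
           (π ^ 2 * (1 - r ^ 2) ^ ((3:ℝ)/2))⁻¹ * μv *
             (Real.sqrt (1 - ρv ^ 2) + ρv * Real.arcsin ρv)
         K₂ ≤ C * m) := by
  have hdiff : Differentiable ℝ γ := hγ.differentiable (by simp)
  obtain ⟨B, hB0, hB⟩ := exists_deriv_sub_sq_le (L := L) hγ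
  set K := B + 5 with hKdef
  have hK : 1 ≤ K := by linarith
  have hK0 : 0 < K := by linarith
  refine ⟨1 / (20 * K), by positivity, 100 * K * (2 * π ^ 2), by positivity, ?_⟩
  intro m hm hab t₁ h1 t₂ h2 hne hlt
  have hN := latN_pos hab
  have hm1 : (1 : ℝ) ≤ m := by exact_mod_cast hm
  set A := 2 * π ^ 2 * (m : ℝ) with hA
  have hπ := pi_gt_three
  have hA1 : 1 ≤ A := by nlinarith
  set s := t₁ - t₂ with hs
  have hs0 : s ≠ 0 := sub_ne_zero.mpr hne
  obtain ⟨q, hq⟩ : ∃ q, q = A * s ^ 2 := ⟨_, rfl⟩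
  have hq0 : 0 < q := by rw [hq]; positivity
  have hsq : s ^ 2 ≤ q := by nlinarith [sq_nonneg s]
  have hKq : K * q ≤ 1 / 10 := by
    rw [abs_sub_comm, lt_div_iff₀ (by positivity)] at hlt
    have h := pow_le_pow_left₀ (by positivity) hlt.le 2
    rw [mul_pow, sq_abs, sq_sqrt (by positivity), div_pow, one_pow,
      le_div_iff₀ (by positivity)] at h
    have hπ4 : π ^ 2 ≤ 16 := by nlinarith [pi_le_four]
    have hX : 0 ≤ s ^ 2 * m := by positivity
    have h' : s ^ 2 * m * K * 400 ≤ 1 := by nlinarith [mul_nonneg hX hK0.le]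
    calc K * q = 2 * π ^ 2 * (s ^ 2 * m * K) := by rw [hq, hA]; ring
      _ ≤ 2 * 16 * (s ^ 2 * m * K) := by gcongr
      _ ≤ _ := by linarith
  have hBs : B * s ^ 2 ≤ B * q := by gcongr
  have hq1 : q ≤ 1 / 2 := by nlinarith
  have hchord := chord_sq_le hdiff hunit h1 h2
  obtain ⟨a₁, ha₁, he₁⟩ := exists_tangent_chord_eq hdiff hunit hB0 hB h1 h2 (Or.inl rfl)
  obtain ⟨a₂, ha₂, he₂⟩ := exists_tangent_chord_eq hdiff hunit hB0 hB h1 h2 (Or.inr rfl)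
  have htan := tangent_inner_bounds hunit hB h1 h2
  rw [← hs] at hchord ha₁ ha₂ he₁ he₂ htan
  have hlen : 2 * π ^ 2 * m * ((γ t₁ - γ t₂).1 ^ 2 + (γ t₁ - γ t₂).2 ^ 2) ≤ q := by
    rw [hq]; gcongr
  have hr := latticeSet_average_cos_bound hN hlen hq1
  have hr₁ := latticeSet_average_sin_bound hN (hunit t₁ h1) hchord hq hq1
  have hr₂ := latticeSet_average_sin_bound hN (hunit t₂ h2) hchord hq hq1
  have hr₁₂ := latticeSet_average_mul_cos_bound hN (hunit t₁ h1) (hunit t₂ h2) hlen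
  rw [he₁] at hr₁
  rw [he₂] at hr₂
  have hr' : |covFn m γ t₁ t₂ - (1 - q / 2)| ≤ K * q ^ 2 := by
    have hlow : (1 - 2 * (B * q)) * s ^ 2 ≤ (γ t₁ - γ t₂).1 ^ 2 + (γ t₁ - γ t₂).2 ^ 2 := by
      have hcs : (a₁ * s) ^ 2 ≤ (γ t₁ - γ t₂).1 ^ 2 + (γ t₁ - γ t₂).2 ^ 2 := by
        rw [← he₁]
        exact inner_sq_le_of_unit (hunit t₁ h1) _ _
      refine le_trans ?_ hcs
      rw [mul_pow]
      gcongr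
      rw [abs_le] at ha₁
      nlinarith [sq_nonneg (a₁ - 1)]
    have hlow' := mul_le_mul_of_nonneg_left hlow (by linarith : 0 ≤ A)
    change |covFn m γ t₁ t₂ - _| ≤ _ at hr
    rw [← hA] at hr hlen
    rw [abs_le] at hr ⊢
    have hlow_eq : A * ((1 - 2 * (B * q)) * s ^ 2) = q - 2 * (B * q ^ 2) := by rw [hq]; ring
    have hKq2 : K * q ^ 2 = B * q ^ 2 + 5 * q ^ 2 := by rw [hKdef]; ring
    have hBq2 : 0 ≤ B * q ^ 2 := by positivity
    rw [hlow_eq] at hlow'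
    constructor <;> linarith [sq_nonneg q]
  have hq_cancel : ∀ {x y ε : ℝ}, 0 < |y| → |x| ≤ ε * |y| → |x / y| ≤ ε := fun hy h => by
    rwa [abs_div, div_le_iff₀ hy]
  have hAs : 0 < |A * s| := abs_pos.mpr (by positivity)
  have hsin : ∀ {x a : ℝ}, |a - 1| ≤ B * s ^ 2 → |x - A * (a * s)| ≤ 4 * A * |s| * q →
      |x / (A * s) - 1| ≤ K * q := by
    intro x a ha hx
    have h4 : |x / (A * s) - a| ≤ 4 * q := by
      rw [show x / (A * s) - a = (x - A * (a * s)) / (A * s) by field_simp]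
      refine hq_cancel hAs (hx.trans (le_of_eq ?_))
      rw [abs_mul, abs_of_pos (by linarith : 0 < A)]
      ring
    have hKq' : K * q = B * q + 5 * q := by rw [hKdef]; ring
    rw [abs_le] at ha h4 ⊢
    constructor <;> linarith
  have hA0 : 0 < A := by linarith
  have hmain := two_point_correlation_le_of_expansion (A := A) (s := s) (q := q) (K := K)
    (r := covFn m γ t₁ t₂) (r₁ := covFn1 m γ t₁ t₂) (r₂ := covFn2 m γ t₁ t₂)
    (r₁₂ := covFn12 m γ t₁ t₂) (e₀ := (covFn m γ t₁ t₂ - (1 - q / 2)) / q)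
    (e₁ := -covFn1 m γ t₁ t₂ / (A * s) - 1) (e₂ := covFn2 m γ t₁ t₂ / (A * s) - 1)
    (e₃ := covFn12 m γ t₁ t₂ / A - 1) hA0 hs0 hq hK hKq (by field_simp; ring)
    (by field_simp; ring) (by field_simp; ring) (by field_simp; ring) ?_ ?_ ?_ ?_
  · rw [show 100 * K * (2 * π ^ 2) * (m : ℝ) = 100 * K * A by rw [hA]; ring]
    exact hmain
  · refine hq_cancel (abs_pos.mpr hq0.ne') (hr'.trans (le_of_eq ?_))
    rw [abs_of_pos hq0]; ring
  · refine hsin ha₁ ?_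
    rw [covFn1_eq m hdiff, neg_neg]
    exact hr₁
  · refine hsin ha₂ ?_
    rw [covFn2, deriv_covFn_right m hdiff]
    exact hr₂
  · rw [← covFn12_eq m hdiff, ← hA] at hr₁₂
    have h2q : |covFn12 m γ t₁ t₂ / A - ((deriv γ t₁).1 * (deriv γ t₂).1 +
        (deriv γ t₁).2 * (deriv γ t₂).2)| ≤ 2 * q := by
      rw [div_sub' hA0.ne']
      refine hq_cancel (abs_pos.mpr hA0.ne') (hr₁₂.trans (le_of_eq ?_))
      rw [abs_of_pos hA0]; ring
    have hKq' : K * q = B * q + 5 * q := by rw [hKdef]; ring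
    rw [abs_le] at htan h2q ⊢
    constructor <;> linarith

end
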